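/- Let A be an arbitrary abelian group. Then the homomorphism A ⊗_ℤ (ℚ/ℤ) → A ⊗_ℤ (ℂ/ℤ) induced by the inclusion ℚ/ℤ ↪ ℂ/ℤ is injective, and its image is exactly the torsion subgroup of A ⊗_ℤ (ℂ/ℤ). -/

import Mathlib

open scoped TensorProduct

/-- Multiplication by a positive integer is injective on `A ⊗ V` for a rational vector space `V`. -/
theorem TensorProduct.eq_zero_of_nsmul_eq_zero_of_rat (A V : Type*) [AddCommGroup A]
    [AddCommGroup V] [Module ℚ V] {n : ℕ} (hn : 0 < n) {w : A ⊗[ℤ] V} (hw : n • w = 0) :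
    w = 0 := by
  let d : V →ₗ[ℤ] V := (LinearMap.lsmul ℚ V (n : ℚ)⁻¹).restrictScalars ℤ
  have hd : n • d = LinearMap.id := by
    ext v
    have hn' : (n : ℚ) ≠ 0 := by positivity
    change n • ((n : ℚ)⁻¹ • v) = v
    rw [← Nat.cast_smul_eq_nsmul ℚ n, smul_inv_smul₀ hn']
  have h : d.lTensor A (n • w) = w := by
    rw [map_nsmul, ← LinearMap.smul_apply]
    have : n • d.lTensor A = (n • d).lTensor A := (map_nsmul (LinearMap.lTensorHom A) n d).symm
    rw [this, hd, LinearMap.lTensor_id_apply]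
  rw [← h, hw, map_zero]

/-- Every element of `A ⊗ B` has finite order when every element of `B` does. -/
theorem TensorProduct.isOfFinAddOrder_of_right {A B : Type*} [AddCommGroup A] [AddCommGroup B]
    (hB : ∀ b : B, IsOfFinAddOrder b) (x : A ⊗[ℤ] B) : IsOfFinAddOrder x := by
  induction x with
  | zero => exact IsOfFinAddOrder.zero
  | tmul a b => exact (TensorProduct.mk ℤ A B a).toAddMonoidHom.isOfFinAddOrder (hB b)
  | add x y hx hy => exact hx.add hy

theorem isOfFinAddOrder_rat_quotient_zmultiples_one (b : ℚ ⧸ AddSubgroup.zmultiples (1 : ℚ)) :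
    IsOfFinAddOrder b := by
  obtain ⟨p, rfl⟩ := QuotientAddGroup.mk_surjective b
  refine isOfFinAddOrder_iff_nsmul_eq_zero.mpr ⟨p.den, p.den_pos, ?_⟩
  rw [← QuotientAddGroup.mk_nsmul, QuotientAddGroup.eq_zero_iff]
  exact ⟨p.num, by simp⟩

/-- For an arbitrary abelian group `A`, the map `A ⊗_ℤ ℚ/ℤ → A ⊗_ℤ ℂ/ℤ` induced by the
inclusion `ℚ/ℤ ↪ ℂ/ℤ` is injective, and its image is exactly the torsion subgroup of
`A ⊗_ℤ ℂ/ℤ`. -/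
theorem tensor_QmodZ_to_CmodZ (A : Type*) [AddCommGroup A] :
    let i : (ℚ ⧸ AddSubgroup.zmultiples (1 : ℚ)) →+ (ℂ ⧸ AddSubgroup.zmultiples (1 : ℂ)) :=
      QuotientAddGroup.map _ _ (Rat.castHom ℂ).toAddMonoidHom
        (by rintro x ⟨k, rfl⟩; exact ⟨k, by push_cast; simp⟩)
    let F := TensorProduct.map (LinearMap.id : A →ₗ[ℤ] A) i.toIntLinearMap
    Function.Injective F ∧ ∀ y, (∃ x, F x = y) ↔ IsOfFinAddOrder y := by
  intro i F
  obtain ⟨r, hr⟩ := (Algebra.linearMap ℚ ℂ).exists_leftInverse_of_injective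
    (LinearMap.ker_eq_bot.mpr (algebraMap ℚ ℂ).injective)
  have hr_cast (p : ℚ) : r (p : ℂ) = p := LinearMap.congr_fun hr p
  have hr_int (k : ℤ) : r (k : ℂ) = k := by simpa using hr_cast k
  -- The retraction `ℂ/ℤ → ℚ/ℤ` and the complementary map `ℂ/ℤ → ℂ`.
  let ρ : (ℂ ⧸ AddSubgroup.zmultiples (1 : ℂ)) →+ (ℚ ⧸ AddSubgroup.zmultiples (1 : ℚ)) :=
    QuotientAddGroup.map _ _ r.toAddMonoidHom (by
      rintro x ⟨k, rfl⟩
      exact ⟨k, by simp [hr_int]⟩)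
  let s : (ℂ ⧸ AddSubgroup.zmultiples (1 : ℂ)) →+ ℂ :=
    QuotientAddGroup.lift _
      (AddMonoidHom.id ℂ - (Rat.castHom ℂ).toAddMonoidHom.comp r.toAddMonoidHom) (by
        rintro x ⟨k, rfl⟩
        simp [hr_int])
  let q : ℂ →+ (ℂ ⧸ AddSubgroup.zmultiples (1 : ℂ)) := QuotientAddGroup.mk' _
  have hρi : ρ.toIntLinearMap ∘ₗ i.toIntLinearMap = LinearMap.id := by
    ext b
    obtain ⟨p, rfl⟩ := QuotientAddGroup.mk_surjective b
    exact congrArg QuotientAddGroup.mk (hr_cast p)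
  have hsplit : i.toIntLinearMap ∘ₗ ρ.toIntLinearMap + q.toIntLinearMap ∘ₗ s.toIntLinearMap =
      LinearMap.id := by
    ext b
    obtain ⟨z, rfl⟩ := QuotientAddGroup.mk_surjective b
    change QuotientAddGroup.mk (((r z : ℚ) : ℂ) + (z - ((r z : ℚ) : ℂ))) = _
    rw [add_sub_cancel]
    rfl
  have hF : F = i.toIntLinearMap.lTensor A := rfl
  have hleft : Function.LeftInverse (ρ.toIntLinearMap.lTensor A) F := fun x => by
    rw [hF, ← LinearMap.lTensor_comp_apply, hρi, LinearMap.lTensor_id_apply]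
  refine ⟨hleft.injective, fun y => ⟨?_, fun hy => ⟨ρ.toIntLinearMap.lTensor A y, ?_⟩⟩⟩
  · rintro ⟨x, rfl⟩
    exact F.toAddMonoidHom.isOfFinAddOrder
      (TensorProduct.isOfFinAddOrder_of_right isOfFinAddOrder_rat_quotient_zmultiples_one x)
  · obtain ⟨n, hn, hny⟩ := isOfFinAddOrder_iff_nsmul_eq_zero.mp hy
    have hs : s.toIntLinearMap.lTensor A y = 0 :=
      TensorProduct.eq_zero_of_nsmul_eq_zero_of_rat A ℂ hn (by rw [← map_nsmul, hny, map_zero])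
    have h := LinearMap.congr_fun (congrArg (LinearMap.lTensor A) hsplit) y
    rwa [LinearMap.lTensor_add, LinearMap.add_apply, LinearMap.lTensor_comp_apply,
      LinearMap.lTensor_comp_apply, hs, map_zero, add_zero, LinearMap.lTensor_id_apply] at h
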